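/- arXiv:2308.06014 — 4 statements merged into one kernel-verified Lean document; each statement's English description precedes it below -/
import Mathlib

section
/- Let M > 4 and ν > 0 be real numbers. Suppose X : [0,∞) → ℝ is C² on [0,∞), C⁴ on (0,∞), has finite energy ∫₀^∞ [X''(s) + ((M−1)/s) X'(s)]² s^{M−1} ds < ∞, satisfies X(0) = 0, and solves the fourth-order ordinary differential equation [s^{1−M} (d/ds)(s^{M−1} (d/ds))]² X(s) = ν (1+s²)^{−4} X(s) for all s ∈ (0,∞). Then X ≡ 0 on [0,∞). -/
open Real MeasureTheory Filter

noncomputable section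

/-- Laplacian of a real-valued function on Euclidean space. -/
def lap {N : ℕ} (u : EuclideanSpace ℝ (Fin N) → ℝ) (x : EuclideanSpace ℝ (Fin N)) : ℝ :=
  ∑ i : Fin N, fderiv ℝ (fun y => fderiv ℝ u y (EuclideanSpace.single i 1)) x
    (EuclideanSpace.single i 1)

/-- The weighted operator `div(|x|^α ∇u)(x) = |x|^α Δu(x) + α |x|^(α-2) (x · ∇u(x))`.
Note that `x · ∇u(x)` is the directional derivative of `u` at `x` along `x`. -/
def wOp {N : ℕ} (α : ℝ) (u : EuclideanSpace ℝ (Fin N) → ℝ) (x : EuclideanSpace ℝ (Fin N)) : ℝ :=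
  ‖x‖ ^ α * lap u x + α * ‖x‖ ^ (α - 2) * fderiv ℝ u x x

/-- The constant `C_{N,α} = [(N−4+2α)(N−2+α)N(N+2−α)]^{(N−4+2α)/(8−4α)}`. -/
def Cconst (N : ℕ) (α : ℝ) : ℝ :=
  (((N : ℝ) - 4 + 2*α) * ((N : ℝ) - 2 + α) * (N : ℝ) * ((N : ℝ) + 2 - α)) ^
    (((N : ℝ) - 4 + 2*α) / (8 - 4*α))

/-- The radial solution `U_{λ,α}(x) = C_{N,α} λ^{(N−4+2α)/2} (1+λ^{2−α}|x|^{2−α})^{−(N−4+2α)/(2−α)}`. -/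
def Usol (N : ℕ) (α lam : ℝ) (x : EuclideanSpace ℝ (Fin N)) : ℝ :=
  Cconst N α * lam ^ (((N : ℝ) - 4 + 2*α)/2) *
    (1 + lam ^ (2-α) * ‖x‖ ^ (2-α)) ^ (-(((N : ℝ) - 4 + 2*α)/(2-α)))

/-- The critical exponent `2**_α = 2N/(N-4+2α)`. -/
def pexp (N : ℕ) (α : ℝ) : ℝ := 2*(N : ℝ)/((N : ℝ) - 4 + 2*α)

/-- The constant `C(M) = (M−4)(M−2)M(M+2)(Γ(M/2)²/(2Γ(M)))^{4/M}`. -/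
def CM (M : ℝ) : ℝ :=
  (M-4)*(M-2)*M*(M+2) * (Real.Gamma (M/2)^2 / (2*Real.Gamma M)) ^ ((4 : ℝ)/M)

/-- The sharp radial constant `S^{rad}_{N,α}`. -/
def Srad (N : ℕ) (α : ℝ) : ℝ :=
  ((2-α)/2) ^ ((4 : ℝ) - (4-2*α)/(N : ℝ)) *
    (2 * Real.pi ^ ((N : ℝ)/2) / Real.Gamma ((N : ℝ)/2)) ^ ((4-2*α)/(N : ℝ)) *
    CM (2*(N : ℝ)/(2-α))

open Set Topology

/-- Functions on `(0, T]` with ordered derivatives have ordered increments from `0⁺`. -/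
lemma add_le_add_of_hasDerivAt_le {f g f' g' : ℝ → ℝ} {a b T : ℝ}
    (hf : ∀ s ∈ Ioc 0 T, HasDerivAt f (f' s) s) (hg : ∀ s ∈ Ioc 0 T, HasDerivAt g (g' s) s)
    (hle : ∀ s ∈ Ioc 0 T, f' s ≤ g' s)
    (ha : Tendsto f (𝓝[>] 0) (𝓝 a)) (hb : Tendsto g (𝓝[>] 0) (𝓝 b)) :
    ∀ s ∈ Ioc 0 T, f s + b ≤ g s + a := by
  intro s hs
  have hd : ∀ t ∈ Ioc 0 T, HasDerivAt (fun t => g t - f t) (g' t - f' t) t :=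
    fun t ht => (hg t ht).sub (hf t ht)
  have hmono : MonotoneOn (fun t => g t - f t) (Ioc 0 T) := by
    apply monotoneOn_of_deriv_nonneg (convex_Ioc 0 T)
    · exact fun t ht => (hd t ht).continuousAt.continuousWithinAt
    · exact fun t ht => (hd t (interior_subset ht)).differentiableAt.differentiableWithinAt
    · intro t ht
      rw [(hd t (interior_subset ht)).deriv]
      linarith [hle t (interior_subset ht)]
  have hlim : b - a ≤ g s - f s := by
    refine le_of_tendsto (hb.sub ha) ?_
    filter_upwards [Ioo_mem_nhdsGT hs.1] with t ht
    exact hmono ⟨ht.1, ht.2.le.trans hs.2⟩ hs ht.2.le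
  linarith

lemma exists_tendsto_nhdsGT_zero_of_abs_deriv_le {f f' : ℝ → ℝ} {C T : ℝ} (hT : 0 < T)
    (hf : ∀ s ∈ Ioc 0 T, HasDerivAt f (f' s) s) (hC : ∀ s ∈ Ioc 0 T, |f' s| ≤ C) :
    ∃ a, Tendsto f (𝓝[>] 0) (𝓝 a) := by
  have hLip : LipschitzOnWith C.toNNReal f (Ioc 0 T) := by
    refine (convex_Ioc 0 T).lipschitzOnWith_of_nnnorm_hasDerivWithin_le
      (fun s hs => (hf s hs).hasDerivWithinAt) (fun s hs => ?_)
    rw [← NNReal.coe_le_coe, coe_nnnorm, Real.norm_eq_abs]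
    exact (hC s hs).trans (Real.le_coe_toNNReal C)
  obtain ⟨g, hg, hfg⟩ := hLip.extend_real
  refine ⟨g 0, (hg.continuous.tendsto 0 |>.mono_left nhdsWithin_le_nhds).congr' ?_⟩
  filter_upwards [Ioc_mem_nhdsGT hT] with s hs
  exact (hfg hs).symm

/-- Comparison for the radial operator `u ↦ s⁻ᵐ d/ds (sᵐ du/ds)`. -/
lemma radial_comparison {m a b T : ℝ} {u u₁ h v v₁ k : ℝ → ℝ}
    (hu : ∀ s ∈ Ioc 0 T, HasDerivAt u (u₁ s) s)
    (hu₁ : ∀ s ∈ Ioc 0 T, HasDerivAt (fun s => s ^ m * u₁ s) (s ^ m * h s) s)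
    (hv : ∀ s ∈ Ioc 0 T, HasDerivAt v (v₁ s) s)
    (hv₁ : ∀ s ∈ Ioc 0 T, HasDerivAt (fun s => s ^ m * v₁ s) (s ^ m * k s) s)
    (hu₁0 : Tendsto (fun s => s ^ m * u₁ s) (𝓝[>] 0) (𝓝 0))
    (hv₁0 : Tendsto (fun s => s ^ m * v₁ s) (𝓝[>] 0) (𝓝 0))
    (hu0 : Tendsto u (𝓝[>] 0) (𝓝 a)) (hv0 : Tendsto v (𝓝[>] 0) (𝓝 b))
    (hhk : ∀ s ∈ Ioc 0 T, h s ≤ k s) :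
    ∀ s ∈ Ioc 0 T, u s + b ≤ v s + a := by
  refine add_le_add_of_hasDerivAt_le hu hv (fun s hs => ?_) hu0 hv0
  have := add_le_add_of_hasDerivAt_le hu₁ hv₁
    (fun t ht => mul_le_mul_of_nonneg_left (hhk t ht) (Real.rpow_nonneg ht.1.le m))
    hu₁0 hv₁0 s hs
  simp only [add_zero] at this
  exact le_of_mul_le_mul_left this (Real.rpow_pos_of_pos hs.1 m)

lemma hasDerivAt_rpow_mul {m s : ℝ} (hs : 0 < s) {u : ℝ → ℝ} {u' : ℝ} (hu : HasDerivAt u u' s) :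
    HasDerivAt (fun s => s ^ m * u s) (s ^ m * (u' + m / s * u s)) s := by
  have h := (Real.hasDerivAt_rpow_const (p := m) (Or.inl hs.ne')).mul hu
  refine h.congr_deriv ?_
  rw [Real.rpow_sub_one hs.ne']
  field_simp
  ring

lemma tendsto_rpow_mul_nhdsGT_zero {m C T : ℝ} (hm : 0 < m) (hT : 0 < T) {u : ℝ → ℝ}
    (hu : ∀ s ∈ Ioc 0 T, |u s| ≤ C) : Tendsto (fun s => s ^ m * u s) (𝓝[>] 0) (𝓝 0) := by
  have h0 : Tendsto (fun s : ℝ => s ^ m) (𝓝[>] 0) (𝓝 0) := by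
    have := (Real.continuous_rpow_const hm.le).tendsto 0
    rw [Real.zero_rpow hm.ne'] at this
    exact this.mono_left nhdsWithin_le_nhds
  refine h0.zero_mul_isBoundedUnder_le ?_
  refine isBoundedUnder_of_eventually_le (a := C) ?_
  filter_upwards [Ioc_mem_nhdsGT hT] with s hs
  exact hu s hs

/-- Solutions of `s⁻ᵐ d/ds (sᵐ du/ds) = h` starting at `0`, with exponentially bounded `h`. -/
lemma radial_exp_bound {m l K T : ℝ} (hm : 0 < m) (hl : 0 < l) (hK : 0 ≤ K) {u u₁ h : ℝ → ℝ}
    (hu : ∀ s ∈ Ioc 0 T, HasDerivAt u (u₁ s) s)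
    (hu₁ : ∀ s ∈ Ioc 0 T, HasDerivAt (fun s => s ^ m * u₁ s) (s ^ m * h s) s)
    (hu₁0 : Tendsto (fun s => s ^ m * u₁ s) (𝓝[>] 0) (𝓝 0))
    (hu0 : Tendsto u (𝓝[>] 0) (𝓝 0))
    (hh : ∀ s ∈ Ioc 0 T, |h s| ≤ K * exp (l * s)) :
    ∀ s ∈ Ioc 0 T, |u s| ≤ K / l ^ 2 * exp (l * s) := by
  have hexp : ∀ A s : ℝ, HasDerivAt (fun s => A / l * exp (l * s)) (A * exp (l * s)) s := by
    intro A s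
    have h := (((hasDerivAt_id s).const_mul l).exp).const_mul (A / l)
    refine h.congr_deriv ?_
    simp only [id_eq]
    field_simp
  have hv : ∀ s ∈ Ioc 0 T,
      HasDerivAt (fun s => K / l ^ 2 * exp (l * s)) (K / l * exp (l * s)) s := by
    intro s _
    have h := hexp (K / l) s
    rwa [div_div, ← sq] at h
  have hv₁ : ∀ s ∈ Ioc 0 T, HasDerivAt (fun s => s ^ m * (K / l * exp (l * s)))
      (s ^ m * (K * exp (l * s) + m / s * (K / l * exp (l * s)))) s :=
    fun s hs => hasDerivAt_rpow_mul hs.1 (hexp K s)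
  have hv₁0 : Tendsto (fun s => s ^ m * (K / l * exp (l * s))) (𝓝[>] 0) (𝓝 0) := by
    refine tendsto_rpow_mul_nhdsGT_zero (C := K / l * exp l) hm one_pos (fun s hs => ?_)
    rw [abs_of_nonneg (by positivity)]
    gcongr
    nlinarith [hs.2]
  have hv0 : Tendsto (fun s => K / l ^ 2 * exp (l * s)) (𝓝[>] 0) (𝓝 (K / l ^ 2)) := by
    have hc : Continuous fun s => K / l ^ 2 * exp (l * s) := by fun_prop
    have := hc.tendsto 0
    simp only [mul_zero, Real.exp_zero, mul_one] at this
    exact this.mono_left nhdsWithin_le_nhds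
  have hk : ∀ s ∈ Ioc 0 T, |h s| ≤ K * exp (l * s) + m / s * (K / l * exp (l * s)) := by
    intro s hs
    have := hs.1
    have : 0 ≤ m / s * (K / l * exp (l * s)) := by positivity
    linarith [hh s hs]
  have hb : 0 ≤ K / l ^ 2 := by positivity
  intro s hs
  have h1 := radial_comparison hu hu₁ hv hv₁ hu₁0 hv₁0 hu0 hv0
    (fun s hs => (le_abs_self _).trans (hk s hs)) s hs
  have h2 := radial_comparison (u := fun s => -u s) (u₁ := fun s => -u₁ s) (h := fun s => -h s)
    (a := 0) (m := m) (fun s hs => (hu s hs).neg)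
    (fun s hs => by simpa only [mul_neg] using (hu₁ s hs).fun_neg) hv hv₁
    (by simpa using hu₁0.neg) hv₁0 (by simpa using hu0.neg) hv0
    (fun s hs => (neg_le_abs _).trans (hk s hs)) s hs
  rw [abs_le]
  constructor <;> linarith

/-- A function of size `O(1/s)` at `0⁺` has no positive flux `sᵐ du/ds` there when `m > 3`. -/
lemma flux_nonpos {m c C : ℝ} (hm : 3 < m) {u u₁ : ℝ → ℝ}
    (hu : ∀ s > 0, HasDerivAt u (u₁ s) s)
    (hC : ∀ s ∈ Ioc (0 : ℝ) 1, |s * u s| ≤ C)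
    (hc : Tendsto (fun s => s ^ m * u₁ s) (𝓝[>] 0) (𝓝 c)) : c ≤ 0 := by
  by_contra! hpos
  have hev := hc.eventually_const_lt (half_lt_self hpos)
  obtain ⟨d, hd, hsub⟩ := mem_nhdsGT_iff_exists_Ioc_subset.1
    (inter_mem hev (Ioc_mem_nhdsGT (zero_lt_one' ℝ)))
  have hder : ∀ s > 0, HasDerivAt (fun s => u s + c / 4 * (s ^ 2)⁻¹)
      (u₁ s - c / 2 * (s ^ 3)⁻¹) s := by
    intro s hs
    have h := (hu s hs).add ((((hasDerivAt_id s).pow 2).inv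
      (pow_ne_zero 2 hs.ne')).const_mul (c / 4))
    refine h.congr_deriv ?_
    simp only [Pi.pow_apply, id_eq]
    field_simp
    ring
  have hmono : MonotoneOn (fun s => u s + c / 4 * (s ^ 2)⁻¹) (Ioc 0 d) := by
    apply monotoneOn_of_deriv_nonneg (convex_Ioc 0 d)
    · exact fun t ht => (hder t ht.1).continuousAt.continuousWithinAt
    · exact fun t ht =>
        (hder t (interior_subset ht).1).differentiableAt.differentiableWithinAt
    · intro t ht
      have ht := interior_subset ht
      rw [(hder t ht.1).deriv]
      have h1 : c / 2 < t ^ m * u₁ t := (hsub ht).1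
      have h2 : t ^ m ≤ t ^ 3 := by
        rw [← Real.rpow_natCast]
        exact Real.rpow_le_rpow_of_exponent_ge ht.1 (hsub ht).2.2 (by norm_num; exact hm.le)
      have h3 : 0 < t ^ m := Real.rpow_pos_of_pos ht.1 m
      have h4 : 0 < u₁ t := by
        by_contra! h
        nlinarith
      have h5 : c / 2 ≤ u₁ t * t ^ 3 := by nlinarith
      have h6 : c / 2 * (t ^ 3)⁻¹ ≤ u₁ t := by
        rw [← div_eq_mul_inv, div_le_iff₀ (pow_pos ht.1 3)]
        exact h5
      linarith
  set B := u d + c / 4 * (d ^ 2)⁻¹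
  have hlim : Tendsto (fun s => C * s + B * s ^ 2) (𝓝[>] 0) (𝓝 0) := by
    have hcont : Continuous fun s => C * s + B * s ^ 2 := by fun_prop
    have := hcont.tendsto 0
    norm_num at this
    exact this.mono_left nhdsWithin_le_nhds
  have : c / 4 ≤ 0 := by
    refine ge_of_tendsto hlim ?_
    filter_upwards [Ioc_mem_nhdsGT hd] with s hs
    have h1 : u s + c / 4 * (s ^ 2)⁻¹ ≤ B := hmono hs ⟨hd, le_rfl⟩ hs.2
    have h2 := (abs_le.1 (hC s (hsub hs).2)).1
    have hs0 : 0 < s := hs.1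
    have h3 : (u s + c / 4 * (s ^ 2)⁻¹) * s ^ 2 = s * u s * s + c / 4 := by
      field_simp
    have h4 := mul_le_mul_of_nonneg_right h1 (sq_nonneg s)
    nlinarith
  linarith

/-- If `Y(0⁺) > 0`, then the first-order system for `(X, Y)` keeps `Y` bounded below. -/
lemma le_of_radial_system {m y : ℝ} (hy : 0 < y) {X X₁ Y Y₁ w : ℝ → ℝ}
    (hX : ∀ s > 0, HasDerivAt X (X₁ s) s)
    (hX₁ : ∀ s > 0, HasDerivAt (fun s => s ^ m * X₁ s) (s ^ m * Y s) s)
    (hY : ∀ s > 0, HasDerivAt Y (Y₁ s) s)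
    (hY₁ : ∀ s > 0, HasDerivAt (fun s => s ^ m * Y₁ s) (s ^ m * (w s * X s)) s)
    (hw : ∀ s > 0, 0 ≤ w s)
    (hX0 : Tendsto X (𝓝[>] 0) (𝓝 0)) (hX₁0 : Tendsto (fun s => s ^ m * X₁ s) (𝓝[>] 0) (𝓝 0))
    (hY0 : Tendsto Y (𝓝[>] 0) (𝓝 y)) (hY₁0 : Tendsto (fun s => s ^ m * Y₁ s) (𝓝[>] 0) (𝓝 0)) :
    ∀ s > 0, y / 2 ≤ Y s := by
  have hzero : ∀ T : ℝ, ∀ s ∈ Ioc 0 T, HasDerivAt (fun _ : ℝ => (0 : ℝ)) 0 s :=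
    fun _ s _ => hasDerivAt_const s 0
  have hzero₁ : ∀ T : ℝ, ∀ s ∈ Ioc 0 T,
      HasDerivAt (fun s : ℝ => s ^ m * (0 : ℝ)) (s ^ m * 0) s := by
    intro _ s _
    simpa using hasDerivAt_const s (0 : ℝ)
  have hstep : ∀ T > 0, (∀ s ∈ Ioc 0 T, 0 ≤ Y s) → y ≤ Y T := by
    intro T hT hpos
    have hXpos : ∀ s ∈ Ioc 0 T, 0 ≤ X s := by
      intro s hs
      simpa using radial_comparison (hzero T) (hzero₁ T) (fun s hs => hX s hs.1)
        (fun s hs => hX₁ s hs.1) (by simp) hX₁0 tendsto_const_nhds hX0 hpos s hs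
    simpa using radial_comparison (hzero T) (hzero₁ T) (fun s hs => hY s hs.1)
      (fun s hs => hY₁ s hs.1) (by simp) hY₁0 tendsto_const_nhds hY0
      (fun s hs => mul_nonneg (hw s hs.1) (hXpos s hs)) T ⟨hT, le_rfl⟩
  obtain ⟨e, he, hsub⟩ := mem_nhdsGT_iff_exists_Ioc_subset.1
    (hY0.eventually_const_lt (half_lt_self hy))
  by_contra! hcon
  obtain ⟨t, ht, hYt⟩ := hcon
  have hclosed : IsClosed (Ici e ∩ Y ⁻¹' Iic (y / 2)) := by
    refine ContinuousOn.preimage_isClosed_of_isClosed (fun s hs => ?_) isClosed_Ici isClosed_Iic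
    exact (hY s (lt_of_lt_of_le he hs)).continuousAt.continuousWithinAt
  have hmemS : ∀ s > 0, Y s ≤ y / 2 → s ∈ Ici e ∩ Y ⁻¹' Iic (y / 2) := by
    intro s hs hYs
    refine ⟨?_, hYs⟩
    by_contra hse
    have : y / 2 < Y s := hsub ⟨hs, (not_le.1 hse).le⟩
    linarith
  have hbdd : BddBelow (Ici e ∩ Y ⁻¹' Iic (y / 2)) := ⟨e, fun s hs => hs.1⟩
  have hmem := hclosed.csInf_mem ⟨t, hmemS t ht hYt.le⟩ hbdd
  set a := sInf (Ici e ∩ Y ⁻¹' Iic (y / 2))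
  have ha : 0 < a := lt_of_lt_of_le he hmem.1
  have hbefore : ∀ s ∈ Ioo 0 a, y / 2 < Y s := by
    intro s hs
    by_contra! h
    exact (csInf_le hbdd (hmemS s hs.1 h)).not_gt hs.2
  have hYa : Y a ≤ y / 2 := hmem.2
  have hYa' : y / 2 ≤ Y a := by
    refine ge_of_tendsto ((hY a ha).continuousAt.tendsto.mono_left
      (nhdsWithin_le_nhds (s := Iio a))) ?_
    filter_upwards [Ioo_mem_nhdsLT ha] with s hs
    exact (hbefore s hs).le
  have := hstep a ha (fun s hs => by
    rcases hs.2.eq_or_lt with h | h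
    · rw [h]; linarith
    · linarith [hbefore s ⟨hs.1, h⟩])
  linarith

/-- A function with a positive lower bound has infinite weighted energy. -/
lemma not_integrableOn_sq_mul_rpow {m y : ℝ} (hm : 0 ≤ m) (hy : 0 < y) {Y : ℝ → ℝ}
    (hY : ∀ s > 0, y ≤ Y s) : ¬ IntegrableOn (fun s => Y s ^ 2 * s ^ m) (Ioi 0) := by
  intro hint
  have h1 : IntegrableOn (fun _ : ℝ => y ^ 2) (Ioi 1) := by
    refine (hint.mono_set (Ioi_subset_Ioi zero_le_one)).mono' (by fun_prop) ?_
    filter_upwards [ae_restrict_mem measurableSet_Ioi] with s hs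
    have hs : 1 < s := hs
    rw [Real.norm_of_nonneg (sq_nonneg y)]
    have h2 : y ^ 2 ≤ Y s ^ 2 := by
      gcongr
      exact hY s (by linarith)
    have h3 : 1 ≤ s ^ m := Real.one_le_rpow hs.le hm
    nlinarith [sq_nonneg (Y s)]
  rw [integrableOn_const_iff] at h1
  rcases h1 with h1 | h1
  · exact (pow_pos hy 2).ne' (by simpa using h1)
  · simp at h1

lemma eq_zero_of_radial_system {m C ν : ℝ} (hm : 3 < m) {X X₁ Y Y₁ w : ℝ → ℝ}
    (hX : ∀ s > 0, HasDerivAt X (X₁ s) s)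
    (hX₁ : ∀ s > 0, HasDerivAt (fun s => s ^ m * X₁ s) (s ^ m * Y s) s)
    (hY : ∀ s > 0, HasDerivAt Y (Y₁ s) s)
    (hY₁ : ∀ s > 0, HasDerivAt (fun s => s ^ m * Y₁ s) (s ^ m * (w s * X s)) s)
    (hw : ∀ s > 0, 0 ≤ w s) (hwν : ∀ s > 0, w s ≤ ν)
    (hXc : ContinuousOn X (Ici 0)) (hX0 : X 0 = 0)
    (hX₁b : ∀ s ∈ Ioc (0 : ℝ) 1, |X₁ s| ≤ C)
    (hYb : ∀ s ∈ Ioc (0 : ℝ) 1, |s * Y s| ≤ C)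
    (hE : IntegrableOn (fun s => Y s ^ 2 * s ^ m) (Ioi 0)) :
    ∀ s ≥ 0, X s = 0 := by
  have hm0 : 0 < m := by linarith
  have hν : 0 ≤ ν := (hw 1 one_pos).trans (hwν 1 one_pos)
  have hXlim : Tendsto X (𝓝[>] 0) (𝓝 0) := by
    have := hXc 0 self_mem_Ici
    rw [ContinuousWithinAt, hX0] at this
    exact this.mono_left (nhdsWithin_mono 0 Ioi_subset_Ici_self)
  have hX₁0 := tendsto_rpow_mul_nhdsGT_zero hm0 one_pos hX₁b
  obtain ⟨D, hD⟩ := (isCompact_Icc (a := (0 : ℝ)) (b := 1)).exists_bound_of_continuousOn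
    (hXc.mono Icc_subset_Ici_self)
  have hD0 : 0 ≤ D := (norm_nonneg _).trans (hD 0 ⟨le_rfl, zero_le_one⟩)
  have hwX : ∀ s ∈ Ioc (0 : ℝ) 1, |w s * X s| ≤ ν * D := by
    intro s hs
    rw [abs_mul, abs_of_nonneg (hw s hs.1)]
    exact mul_le_mul (hwν s hs.1) (hD s ⟨hs.1.le, hs.2⟩) (abs_nonneg _) hν
  obtain ⟨c, hc⟩ := exists_tendsto_nhdsGT_zero_of_abs_deriv_le (C := ν * D) one_pos
    (fun s hs => hY₁ s hs.1) (fun s hs => by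
      rw [abs_mul, abs_of_nonneg (Real.rpow_nonneg hs.1.le m)]
      have := Real.rpow_le_one hs.1.le hs.2 hm0.le
      exact (mul_le_of_le_one_left (abs_nonneg _) this).trans (hwX s hs))
  have hc0 : c = 0 := by
    refine le_antisymm (flux_nonpos hm hY hYb hc) ?_
    have := flux_nonpos (u := fun s => -Y s) (u₁ := fun s => -Y₁ s) (c := -c) hm
      (fun s hs => (hY s hs).neg) (by simpa using hYb) (by simpa using hc.neg)
    linarith
  subst hc0
  have hY₁b : ∀ s ∈ Ioc (0 : ℝ) 1, |Y₁ s| ≤ ν * D := by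
    have hlin : ∀ s ∈ Ioc (0 : ℝ) 1, HasDerivAt (fun s => s ^ m * (ν * D * s))
        (s ^ m * (ν * D * 1 + m / s * (ν * D * s))) s :=
      fun s hs => hasDerivAt_rpow_mul hs.1 ((hasDerivAt_id s).const_mul (ν * D))
    have hlin0 : Tendsto (fun s => s ^ m * (ν * D * s)) (𝓝[>] 0) (𝓝 0) := by
      refine tendsto_rpow_mul_nhdsGT_zero (C := ν * D) hm0 one_pos (fun s hs => ?_)
      have := hs.1
      rw [abs_of_nonneg (by positivity)]
      exact mul_le_of_le_one_right (by positivity) hs.2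
    have hle : ∀ s ∈ Ioc (0 : ℝ) 1,
        |w s * X s| ≤ ν * D * 1 + m / s * (ν * D * s) := by
      intro s hs
      have := hs.1
      have : 0 ≤ m / s * (ν * D * s) := by positivity
      linarith [hwX s hs]
    intro s hs
    have hpos := Real.rpow_pos_of_pos hs.1 m
    have h1 := add_le_add_of_hasDerivAt_le (fun s hs => hY₁ s hs.1) hlin
      (fun t ht => mul_le_mul_of_nonneg_left ((le_abs_self _).trans (hle t ht))
        (Real.rpow_nonneg ht.1.le m)) hc hlin0 s hs
    have h2 := add_le_add_of_hasDerivAt_le (fun s hs => (hY₁ s hs.1).fun_neg) hlin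
      (fun t ht => by
        rw [← mul_neg]
        exact mul_le_mul_of_nonneg_left ((neg_le_abs _).trans (hle t ht))
          (Real.rpow_nonneg ht.1.le m)) (by simpa using hc.neg) hlin0 s hs
    rw [← mul_neg] at h2
    simp only [add_zero] at h1 h2
    have h1 := le_of_mul_le_mul_left h1 hpos
    have h2 := le_of_mul_le_mul_left h2 hpos
    have h3 : ν * D * s ≤ ν * D := mul_le_of_le_one_right (by positivity) hs.2
    rw [abs_le]
    constructor <;> linarith
  obtain ⟨y, hy⟩ := exists_tendsto_nhdsGT_zero_of_abs_deriv_le one_pos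
    (fun s hs => hY s hs.1) hY₁b
  have hy0 : y = 0 := by
    rcases lt_trichotomy y 0 with h | h | h
    · refine absurd ?_ (not_integrableOn_sq_mul_rpow hm0.le (half_pos (neg_pos.2 h))
        (le_of_radial_system (m := m) (X := fun s => -X s) (X₁ := fun s => -X₁ s)
          (Y := fun s => -Y s) (Y₁ := fun s => -Y₁ s) (w := w) (neg_pos.2 h)
          (fun s hs => (hX s hs).neg)
          (fun s hs => by simpa only [mul_neg] using (hX₁ s hs).fun_neg)
          (fun s hs => (hY s hs).neg)
          (fun s hs => by simpa only [mul_neg] using (hY₁ s hs).fun_neg)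
          hw (by simpa using hXlim.neg) (by simpa using hX₁0.neg) hy.neg
          (by simpa using hc.neg)))
      simpa using hE
    · exact h
    · exact absurd hE (not_integrableOn_sq_mul_rpow hm0.le (half_pos h)
        (le_of_radial_system h hX hX₁ hY hY₁ hw hXlim hX₁0 hy hc))
  subst hy0
  intro T hT
  set l := ν + 1
  have hl : 0 < l := by positivity
  have hν4 : ν < (l ^ 2) ^ 2 := by
    have h1 : 1 ≤ l := by simp [l, hν]
    have h2 : l ≤ l ^ 4 := le_self_pow₀ h1 (by norm_num)
    have h3 : ν < l := lt_add_one ν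
    nlinarith
  obtain ⟨t, ht, hmax⟩ := (isCompact_Icc (a := 0) (b := T)).exists_isMaxOn
    (nonempty_Icc.2 hT) (f := fun s => |X s| * exp (-(l * s)))
    ((hXc.mono Icc_subset_Ici_self).abs.mul (by fun_prop))
  set K := |X t| * exp (-(l * t)) with hKdef
  have hK : 0 ≤ K := by positivity
  have hKle : ∀ s ∈ Icc 0 T, |X s| ≤ K * exp (l * s) := by
    intro s hs
    have h : |X s| * exp (-(l * s)) ≤ K := hmax hs
    rwa [Real.exp_neg, ← div_eq_mul_inv, div_le_iff₀ (exp_pos _)] at h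
  have hYexp := radial_exp_bound (T := T) (K := ν * K) (h := fun s => w s * X s) hm0 hl
    (by positivity) (fun s hs => hY s hs.1)
    (fun s hs => hY₁ s hs.1) hc hy (fun s hs => by
      rw [abs_mul, abs_of_nonneg (hw s hs.1), mul_assoc]
      exact mul_le_mul (hwν s hs.1) (hKle s ⟨hs.1.le, hs.2⟩) (abs_nonneg _) hν)
  have hXexp := radial_exp_bound (T := T) hm0 hl (by positivity) (fun s hs => hX s hs.1)
    (fun s hs => hX₁ s hs.1) hX₁0 hXlim hYexp
  have hK0 : K = 0 := by
    rcases ht.1.eq_or_lt with h | h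
    · rw [hKdef, ← h, hX0]
      simp
    · have h1 := hXexp t ⟨h, ht.2⟩
      have h2 : K ≤ ν * K / l ^ 2 / l ^ 2 := by
        refine le_of_mul_le_mul_right ?_ (exp_pos (l * t))
        rwa [hKdef, mul_assoc, ← Real.exp_add, neg_add_cancel, Real.exp_zero, mul_one, ← hKdef]
      rw [div_div, ← sq, le_div_iff₀ (by positivity)] at h2
      nlinarith
  have := hKle T ⟨hT, le_rfl⟩
  rw [hK0, zero_mul] at this
  exact abs_eq_zero.1 (le_antisymm this (abs_nonneg _))

/-- a finite-energy solution of
`[s^{1−M}(d/ds)(s^{M−1}(d/ds))]² X = ν(1+s²)^{−4} X` on `(0,∞)` with `X(0) = 0` vanishes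
identically (extension of Bartsch–Weth–Willem's Lemma 2.4 to real `M > 4`). -/
theorem stmt10 (M ν : ℝ) (hM : 4 < M) (hν : 0 < ν) (X : ℝ → ℝ)
    (hX2 : ContDiffOn ℝ 2 X (Set.Ici 0)) (hX4 : ContDiffOn ℝ 4 X (Set.Ioi 0))
    (henergy : IntegrableOn
      (fun s => (deriv (deriv X) s + (M-1)/s * deriv X s)^2 * s^(M-1)) (Set.Ioi 0))
    (hX0 : X 0 = 0)
    (hode : ∀ s ∈ Set.Ioi (0:ℝ),
      (fun t => deriv (deriv (fun r => deriv (deriv X) r + (M-1)/r * deriv X r)) t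
          + (M-1)/t * deriv (fun r => deriv (deriv X) r + (M-1)/r * deriv X r) t) s
        = ν * X s / (1 + s^2)^4) :
    ∀ s ∈ Set.Ici (0:ℝ), X s = 0 := by
  have hdX : ContDiffOn ℝ 3 (deriv X) (Ioi 0) :=
    hX4.deriv_of_isOpen isOpen_Ioi (by norm_num)
  have hddX : ContDiffOn ℝ 2 (deriv (deriv X)) (Ioi 0) :=
    hdX.deriv_of_isOpen isOpen_Ioi (by norm_num)
  set Y : ℝ → ℝ := fun r => deriv (deriv X) r + (M - 1) / r * deriv X r with hYdef
  have hYc : ContDiffOn ℝ 2 Y (Ioi 0) := by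
    refine hddX.add (ContDiffOn.mul ?_ (hdX.of_le (by norm_num)))
    exact contDiffOn_const.div contDiffOn_id (fun s hs => ne_of_gt hs)
  have hdY : ContDiffOn ℝ 1 (deriv Y) (Ioi 0) :=
    hYc.deriv_of_isOpen isOpen_Ioi (by norm_num)
  have hasDeriv : ∀ {n : WithTop ℕ∞} {f : ℝ → ℝ}, ContDiffOn ℝ n f (Ioi 0) → n ≠ 0 →
      ∀ s > 0, HasDerivAt f (deriv f s) s := fun hf hn s hs =>
    ((hf.differentiableOn hn).differentiableAt (Ioi_mem_nhds hs)).hasDerivAt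
  have heq₁ : ∀ s ∈ Ioi (0 : ℝ), derivWithin X (Ici 0) s = deriv X s :=
    fun s hs => derivWithin_of_mem_nhds (Ici_mem_nhds hs)
  have heq₂ : ∀ s ∈ Ioi (0 : ℝ),
      derivWithin (derivWithin X (Ici 0)) (Ici 0) s = deriv (deriv X) s := by
    intro s hs
    rw [derivWithin_of_mem_nhds (Ici_mem_nhds hs)]
    exact (Filter.eventuallyEq_of_mem (Ioi_mem_nhds hs) heq₁).deriv_eq
  have hu := uniqueDiffOn_Ici (0 : ℝ)
  have hc₁ : ContDiffOn ℝ 1 (derivWithin X (Ici 0)) (Ici 0) :=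
    hX2.derivWithin hu (by norm_num)
  have hc₂ : ContinuousOn (derivWithin (derivWithin X (Ici 0)) (Ici 0)) (Ici 0) :=
    hc₁.continuousOn_derivWithin hu le_rfl
  obtain ⟨C₁, hC₁⟩ := (isCompact_Icc (a := (0 : ℝ)) (b := 1)).exists_bound_of_continuousOn
    (hc₁.continuousOn.mono Icc_subset_Ici_self)
  obtain ⟨C₂, hC₂⟩ := (isCompact_Icc (a := (0 : ℝ)) (b := 1)).exists_bound_of_continuousOn
    (f := fun s => s * derivWithin (derivWithin X (Ici 0)) (Ici 0) s
      + (M - 1) * derivWithin X (Ici 0) s)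
    (((continuousOn_id.mul hc₂).add (continuousOn_const.mul hc₁.continuousOn)).mono
      Icc_subset_Ici_self)
  refine eq_zero_of_radial_system (m := M - 1) (C := max C₁ C₂) (ν := ν)
    (X₁ := deriv X) (Y := Y) (Y₁ := deriv Y) (w := fun s => ν / (1 + s ^ 2) ^ 4)
    (by linarith) (hasDeriv hX4 (by norm_num)) ?_ (hasDeriv hYc (by norm_num)) ?_ ?_ ?_
    hX2.continuousOn hX0 ?_ ?_ henergy
  · exact fun s hs => hasDerivAt_rpow_mul hs (hasDeriv hdX (by norm_num) s hs)
  · intro s hs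
    have h := hasDerivAt_rpow_mul (m := M - 1) hs (hasDeriv hdY (by norm_num) s hs)
    have hs' := hode s hs
    beta_reduce at hs'
    rw [hs'] at h
    convert h using 2
    ring
  · intro s _
    positivity
  · intro s _
    exact div_le_self hν.le (one_le_pow₀ (by nlinarith [sq_nonneg s]))
  · intro s hs
    have h := hC₁ s ⟨hs.1.le, hs.2⟩
    rw [heq₁ s hs.1] at h
    exact h.trans (le_max_left _ _)
  · intro s hs
    have h := hC₂ s ⟨hs.1.le, hs.2⟩
    rw [heq₁ s hs.1, heq₂ s hs.1] at h
    refine le_trans (le_of_eq ?_) (h.trans (le_max_right _ _))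
    rw [Real.norm_eq_abs]
    congr 1
    have := hs.1.ne'
    simp only [hYdef]
    field_simp

end
end

section
/- Let M > 4 be a real number. Define X₀(s) = (1−s²)/(1+s²)^{(M−2)/2} and Y₀(s) = −X₀''(s) − ((M−1)/s) X₀'(s) for s > 0. Then Y₀''(s) + ((M−1)/s) Y₀'(s) + (M+4)(M−2)M(M+2)(1+s²)^{−4} X₀(s) = 0 for all s ∈ (0,∞); that is, (X₀, Y₀) solves the linearized radial system (with angular eigenvalue parameter μ = 0). -/
open Real MeasureTheory Filter

noncomputable section

theorem deriv_one_add_sq_rpow_mul (a : ℝ) {q q' : ℝ → ℝ} (hq : ∀ s, HasDerivAt q (q' s) s) :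
    deriv (fun s : ℝ => (1 + s ^ 2) ^ a * q s) =
      fun s => (1 + s ^ 2) ^ (a - 1) * (2 * a * s * q s + (1 + s ^ 2) * q' s) := by
  funext s
  have hg : (0 : ℝ) < 1 + s ^ 2 := by positivity
  have h₁ : HasDerivAt (fun s : ℝ => 1 + s ^ 2) (2 * s) s := by
    simpa using (hasDerivAt_pow 2 s).const_add 1
  have h := (h₁.rpow_const (p := a) (Or.inl hg.ne')).mul (hq s)
  have hpow : (1 + s ^ 2) ^ a = (1 + s ^ 2) ^ (a - 1) * (1 + s ^ 2) := by
    rw [Real.rpow_sub_one hg.ne', div_mul_cancel₀ _ hg.ne']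
  refine h.deriv.trans ?_
  rw [hpow]
  ring

theorem deriv_deriv_one_add_sq_rpow_mul (a : ℝ) {q q' q'' : ℝ → ℝ}
    (hq : ∀ s, HasDerivAt q (q' s) s) (hq' : ∀ s, HasDerivAt q' (q'' s) s) :
    deriv (deriv (fun s : ℝ => (1 + s ^ 2) ^ a * q s)) =
      fun s => (1 + s ^ 2) ^ (a - 2) *
        (2 * (a - 1) * s * (2 * a * s * q s + (1 + s ^ 2) * q' s) + (1 + s ^ 2) *
          (2 * a * q s + 2 * a * s * q' s + 2 * s * q' s + (1 + s ^ 2) * q'' s)) := by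
  have hd : ∀ s, HasDerivAt (fun s : ℝ => 2 * a * s * q s + (1 + s ^ 2) * q' s)
      (2 * a * q s + 2 * a * s * q' s + 2 * s * q' s + (1 + s ^ 2) * q'' s) s := by
    intro s
    have h₁ : HasDerivAt (fun s : ℝ => 1 + s ^ 2) (2 * s) s := by
      simpa using (hasDerivAt_pow 2 s).const_add 1
    refine ((((hasDerivAt_id s).const_mul (2 * a)).mul (hq s)).add
      (h₁.mul (hq' s))).congr_deriv ?_
    simp only [id]
    ring
  rw [deriv_one_add_sq_rpow_mul a hq, deriv_one_add_sq_rpow_mul (a - 1) hd,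
    show a - 1 - 1 = a - 2 by ring]

/-- `(X₀, Y₀)` with `X₀(s) = (1−s²)/(1+s²)^{(M−2)/2}` and
`Y₀ = −X₀'' − ((M−1)/s)X₀'` solves the linearized radial system with parameter `μ = 0`. -/
theorem stmt11 (M : ℝ) (hM : 4 < M) :
    let X₀ : ℝ → ℝ := fun s => (1 - s^2) / (1 + s^2) ^ ((M-2)/2)
    let Y₀ : ℝ → ℝ := fun s => -(deriv (deriv X₀) s) - (M-1)/s * deriv X₀ s
    ∀ s ∈ Set.Ioi (0:ℝ),
      deriv (deriv Y₀) s + (M-1)/s * deriv Y₀ s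
        + (M+4)*(M-2)*M*(M+2) * X₀ s / (1 + s^2)^4 = 0 := by
  intro X₀ Y₀ s hs
  set e : ℝ := (M - 2) / 2 with he
  have hM' : M = 2 * e + 2 := by rw [he]; ring
  clear_value e
  subst hM'
  have hpos : ∀ t : ℝ, 0 < 1 + t ^ 2 := fun t => by positivity
  have hX : X₀ = fun t => (1 + t ^ 2) ^ (-e) * (1 - t ^ 2) := by
    funext t
    simp only [X₀]
    rw [Real.rpow_neg (hpos t).le, div_eq_inv_mul, ← he]
  have hp : ∀ t, HasDerivAt (fun t : ℝ => 1 - t ^ 2) (-2 * t) t := fun t => by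
    simpa using (hasDerivAt_pow 2 t).const_sub 1
  have hp' : ∀ t, HasDerivAt (fun t : ℝ => -2 * t) (-2) t := fun t => by
    simpa using (hasDerivAt_id t).const_mul (-2 : ℝ)
  let q : ℝ → ℝ := fun t =>
    8 * e * (e + 1) + 4 * (1 - e) * (1 + t ^ 2) ^ 2 + 4 * (1 - e) * e * (1 + t ^ 2)
  let q' : ℝ → ℝ := fun t => 16 * (1 - e) * (t + t ^ 3) + 8 * (1 - e) * e * t
  let q'' : ℝ → ℝ := fun t => 16 * (1 - e) * (1 + 3 * t ^ 2) + 8 * (1 - e) * e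
  have hq : ∀ t, HasDerivAt q (q' t) t := fun t => by
    have h₁ : HasDerivAt (fun t : ℝ => 1 + t ^ 2) (2 * t) t := by
      simpa using (hasDerivAt_pow 2 t).const_add 1
    refine ((((h₁.pow 2).const_mul (4 * (1 - e))).const_add (8 * e * (e + 1))).add
      (h₁.const_mul (4 * (1 - e) * e))).congr_deriv ?_
    simp only [q']
    push_cast
    ring
  have hq' : ∀ t, HasDerivAt q' (q'' t) t := fun t => by
    refine ((((hasDerivAt_id t).add (hasDerivAt_pow 3 t)).const_mul (16 * (1 - e))).add
      ((hasDerivAt_id t).const_mul (8 * (1 - e) * e))).congr_deriv ?_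
    simp only [q'']
    push_cast
    ring
  have hY : Set.EqOn Y₀ (fun t => (1 + t ^ 2) ^ (-e - 2) * q t) (Set.Ioi 0) := by
    intro t ht
    have ht0 : t ≠ 0 := ne_of_gt ht
    have hpow : (1 + t ^ 2) ^ (-e - 1) = (1 + t ^ 2) ^ (-e - 2) * (1 + t ^ 2) := by
      rw [← Real.rpow_add_one (hpos t).ne']
      ring_nf
    simp only [Y₀]
    rw [hX, deriv_deriv_one_add_sq_rpow_mul (-e) hp hp', deriv_one_add_sq_rpow_mul (-e) hp]
    simp only [hpow, q]
    field_simp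
    ring
  have hY' := hY.deriv isOpen_Ioi
  have hY'' := hY'.deriv isOpen_Ioi
  rw [hY'' hs, hY' hs, hX, deriv_deriv_one_add_sq_rpow_mul (-e - 2) hq hq',
    deriv_one_add_sq_rpow_mul (-e - 2) hq]
  have hs0 : s ≠ 0 := ne_of_gt hs
  have hg := (hpos s).ne'
  have hpow₁ : (1 + s ^ 2) ^ (-e - 2 - 1) = (1 + s ^ 2) ^ (-e - 2 - 2) * (1 + s ^ 2) := by
    rw [← Real.rpow_add_one hg]
    ring_nf
  have hpow₂ : (1 + s ^ 2) ^ (-e) = (1 + s ^ 2) ^ (-e - 2 - 2) * (1 + s ^ 2) ^ 4 := by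
    rw [← Real.rpow_add_natCast hg]
    congr 1
    push_cast
    ring
  simp only [hpow₁, hpow₂, q, q', q'']
  field_simp
  ring

end
end

section
/- Let M > 4 be a real number. Define X₁(s) = s/(1+s²)^{(M−2)/2} and Y₁(s) = −X₁''(s) − ((M−1)/s) X₁'(s) + ((M−1)/s²) X₁(s) for s > 0. Then Y₁''(s) + ((M−1)/s) Y₁'(s) − ((M−1)/s²) Y₁(s) + (M+4)(M−2)M(M+2)(1+s²)^{−4} X₁(s) = 0 for all s ∈ (0,∞); that is, (X₁, Y₁) solves the linearized radial system with angular eigenvalue parameter μ = M−1. -/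
open Real MeasureTheory Filter

noncomputable section

/-- The first derivative of `s ↦ s (1 + s²)^p`. -/
theorem hasDerivAt_mul_one_add_sq_rpow (p s : ℝ) :
    HasDerivAt (fun t : ℝ => t * (1 + t^2) ^ p)
      ((1 + s^2) ^ p + 2 * p * s^2 * (1 + s^2) ^ (p - 1)) s := by
  have hw : HasDerivAt (fun t : ℝ => 1 + t^2) (2 * s) s := by
    simpa using (hasDerivAt_pow 2 s).const_add 1
  have h := (hasDerivAt_id s).mul (hw.rpow_const (p := p) (Or.inl (by positivity)))
  refine h.congr_deriv ?_
  simp only [id]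
  ring

theorem deriv_mul_one_add_sq_rpow (p : ℝ) :
    deriv (fun t : ℝ => t * (1 + t^2) ^ p) =
      fun s => (1 + s^2) ^ p + 2 * p * s^2 * (1 + s^2) ^ (p - 1) :=
  funext fun s => (hasDerivAt_mul_one_add_sq_rpow p s).deriv

/-- The second derivative of `s ↦ s (1 + s²)^p`. -/
theorem hasDerivAt_deriv_mul_one_add_sq_rpow (p s : ℝ) :
    HasDerivAt (deriv fun t : ℝ => t * (1 + t^2) ^ p)
      (6 * p * s * (1 + s^2) ^ (p - 1) + 4 * p * (p - 1) * s^3 * (1 + s^2) ^ (p - 2)) s := by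
  rw [deriv_mul_one_add_sq_rpow]
  have hw : HasDerivAt (fun t : ℝ => 1 + t^2) (2 * s) s := by
    simpa using (hasDerivAt_pow 2 s).const_add 1
  have hs : (1 + s^2 : ℝ) ≠ 0 := by positivity
  have h := (hw.rpow_const (p := p) (Or.inl hs)).add
    (((hasDerivAt_pow 2 s).const_mul (2 * p)).mul (hw.rpow_const (p := p - 1) (Or.inl hs)))
  refine h.congr_deriv ?_
  rw [show p - 1 - 1 = p - 2 by ring]
  push_cast
  ring

/-- The radial operator with angular eigenvalue `M - 1`. -/
def radialOp (M : ℝ) (f : ℝ → ℝ) (s : ℝ) : ℝ :=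
  deriv (deriv f) s + (M-1)/s * deriv f s - (M-1)/s^2 * f s

theorem radialOp_mul_one_add_sq_rpow (M p : ℝ) {s : ℝ} (hs : s ≠ 0) :
    radialOp M (fun t : ℝ => t * (1 + t^2) ^ p) s =
      2 * p * (M + 2 * p) * (s * (1 + s^2) ^ (p - 1))
        - 4 * p * (p - 1) * (s * (1 + s^2) ^ (p - 2)) := by
  have hw : (0:ℝ) < 1 + s^2 := by positivity
  have h1 : (1 + s^2) ^ (p - 1) = (1 + s^2) ^ (p - 2) * (1 + s^2) := by
    rw [← Real.rpow_add_one hw.ne']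
    congr 1
    ring
  rw [radialOp, (hasDerivAt_deriv_mul_one_add_sq_rpow p s).deriv,
    (hasDerivAt_mul_one_add_sq_rpow p s).deriv, h1]
  field_simp
  ring

theorem radialOp_linear_combination (M a b p q s : ℝ) :
    radialOp M (fun t : ℝ => a * (t * (1 + t^2) ^ p) + b * (t * (1 + t^2) ^ q)) s =
      a * radialOp M (fun t : ℝ => t * (1 + t^2) ^ p) s
        + b * radialOp M (fun t : ℝ => t * (1 + t^2) ^ q) s := by
  have h1 : deriv (fun t : ℝ => a * (t * (1 + t^2) ^ p) + b * (t * (1 + t^2) ^ q)) =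
      fun t => a * deriv (fun t : ℝ => t * (1 + t^2) ^ p) t
        + b * deriv (fun t : ℝ => t * (1 + t^2) ^ q) t := by
    funext t
    exact (((hasDerivAt_mul_one_add_sq_rpow p t).differentiableAt.hasDerivAt.const_mul a).add
      ((hasDerivAt_mul_one_add_sq_rpow q t).differentiableAt.hasDerivAt.const_mul b)).deriv
  have h2 := (((hasDerivAt_deriv_mul_one_add_sq_rpow p s).differentiableAt.hasDerivAt.const_mul
    a).add ((hasDerivAt_deriv_mul_one_add_sq_rpow q s).differentiableAt.hasDerivAt.const_mul
    b)).deriv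
  simp only [radialOp]
  rw [h1]
  erw [h2]
  ring

theorem Filter.EventuallyEq.radialOp_eq {f g : ℝ → ℝ} {s : ℝ} (M : ℝ) (h : f =ᶠ[nhds s] g) :
    radialOp M f s = radialOp M g s := by
  simp only [radialOp, h.deriv.deriv_eq, h.deriv_eq, h.eq_of_nhds]

/-- `(X₁, Y₁)` with `X₁(s) = s/(1+s²)^{(M−2)/2}` and
`Y₁ = −X₁'' − ((M−1)/s)X₁' + ((M−1)/s²)X₁` solves the linearized radial system with
parameter `μ = M−1`. -/
theorem stmt12 (M : ℝ) (hM : 4 < M) :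
    let X₁ : ℝ → ℝ := fun s => s / (1 + s^2) ^ ((M-2)/2)
    let Y₁ : ℝ → ℝ := fun s =>
      -(deriv (deriv X₁) s) - (M-1)/s * deriv X₁ s + (M-1)/s^2 * X₁ s
    ∀ s ∈ Set.Ioi (0:ℝ),
      deriv (deriv Y₁) s + (M-1)/s * deriv Y₁ s - (M-1)/s^2 * Y₁ s
        + (M+4)*(M-2)*M*(M+2) * X₁ s / (1 + s^2)^4 = 0 := by
  intro X₁ Y₁ s hs
  have hs0 : s ≠ 0 := ne_of_gt hs
  have hX : X₁ = fun t => t * (1 + t^2) ^ (-((M-2)/2)) := by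
    funext t
    rw [Real.rpow_neg (by positivity)]
    rfl
  have hY : ∀ t, t ≠ 0 → Y₁ t =
      2 * (M-2) * (t * (1 + t^2) ^ (-(M/2))) + M * (M-2) * (t * (1 + t^2) ^ (-((M+2)/2))) := by
    intro t ht
    have hYL : Y₁ t = -radialOp M X₁ t := by
      simp only [Y₁, radialOp]
      ring
    rw [hYL, hX, radialOp_mul_one_add_sq_rpow M _ ht,
      show -((M-2)/2) - 1 = -(M/2) by ring, show -((M-2)/2) - 2 = -((M+2)/2) by ring]
    ring
  have hLY : radialOp M Y₁ s =
      -((M+4)*(M-2)*M*(M+2)) * (s * (1 + s^2) ^ (-((M-2)/2) - (4:ℕ))) := by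
    have hev : Y₁ =ᶠ[nhds s] _ := (eventually_ne_nhds hs0).mono hY
    rw [hev.radialOp_eq M, radialOp_linear_combination,
      radialOp_mul_one_add_sq_rpow M _ hs0, radialOp_mul_one_add_sq_rpow M _ hs0,
      show -(M/2) - 2 = -((M+2)/2) - 1 by ring,
      show -((M+2)/2) - 2 = -((M-2)/2) - (4:ℕ) by push_cast; ring]
    ring
  change radialOp M Y₁ s + _ = 0
  rw [hLY, hX, Real.rpow_sub_natCast (by positivity)]
  ring

end
end

section
/- Let N ≥ 5 be an integer and let α be a real number with 0 < α < 2. Then there exists a constant C > 1 such that for every u ∈ C_c^∞(ℝ^N): (1/C) ∫_{ℝ^N} |div(|x|^α ∇u)(x)|² dx ≤ ∫_{ℝ^N} |x|^{2α} |Δu(x)|² dx ≤ C ∫_{ℝ^N} |div(|x|^α ∇u)(x)|² dx. -/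
open Real MeasureTheory Filter

noncomputable section

section WeightedIntegrals

variable {N : ℕ}

lemma integral_fderiv_apply_eq_zero {g : EuclideanSpace ℝ (Fin N) → ℝ} (hg : ContDiff ℝ 1 g)
    (hc : HasCompactSupport g) (v : EuclideanSpace ℝ (Fin N)) :
    ∫ x, fderiv ℝ g x v = 0 := by
  have hd : Continuous fun x => fderiv ℝ g x v :=
    (hg.continuous_fderiv one_ne_zero).clm_apply continuous_const
  have h := integral_mul_fderiv_eq_neg_fderiv_mul_of_integrable (μ := volume)
    (f := fun _ : EuclideanSpace ℝ (Fin N) => (1 : ℝ)) (g := g) (v := v)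
    (by simp)
    (by simpa using hd.integrable_of_hasCompactSupport (hc.fderiv_apply ℝ v))
    (by simpa using hg.continuous.integrable_of_hasCompactSupport hc)
    (fun x _ => by fun_prop)
    (fun x _ => (hg.differentiable one_ne_zero) x)
  simpa using h

/-- The locally integrable power weights of the norm act on continuous compactly supported
functions. -/
lemma integrable_norm_rpow_mul {s : ℝ} (hN : 1 ≤ N) (hs : -(N : ℝ) < s)
    {φ : EuclideanSpace ℝ (Fin N) → ℝ} (hφ : Continuous φ) (hc : HasCompactSupport φ) :
    Integrable fun x => ‖x‖ ^ s * φ x := by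
  have hloc : LocallyIntegrable fun x : EuclideanSpace ℝ (Fin N) => ‖x‖ ^ s := by
    refine locallyIntegrable_of_norm_le_rpow (C := 1) (α := -s) (by simpa using hN)
      (by simp; linarith) (ae_of_all _ fun x => ?_) ?_
    · simp [abs_of_nonneg (Real.rpow_nonneg (norm_nonneg x) s)]
    · exact (measurable_norm.pow_const s).aestronglyMeasurable
  exact hloc.integrable_smul_right_of_hasCompactSupport hφ hc

lemma fderiv_rpow_norm_sq_add (p : ℝ) {ε : ℝ} (hε : 0 < ε) (x : EuclideanSpace ℝ (Fin N))
    (i : Fin N) :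
    fderiv ℝ (fun y : EuclideanSpace ℝ (Fin N) => (‖y‖ ^ 2 + ε) ^ p) x
      (EuclideanSpace.single i 1) = 2 * p * (‖x‖ ^ 2 + ε) ^ (p - 1) * x i := by
  have h1 := ((hasStrictFDerivAt_norm_sq x).hasFDerivAt.add_const ε).rpow_const (p := p)
    (Or.inl (by positivity))
  rw [h1.fderiv]
  simp [EuclideanSpace.inner_single_right]
  ring

/-- Divergence theorem for a compactly supported field multiplied by a regularised power weight. -/
lemma integral_div_regularised_eq_zero (p : ℝ) {ε : ℝ} (hε : 0 < ε)
    {V : Fin N → EuclideanSpace ℝ (Fin N) → ℝ} (hV : ∀ i, ContDiff ℝ 1 (V i))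
    (hc : ∀ i, HasCompactSupport (V i)) {φ : EuclideanSpace ℝ (Fin N) → ℝ}
    (hφ : ∀ x, ∑ i, x i * V i x = ‖x‖ ^ 2 * φ x) :
    ∫ x, ((‖x‖ ^ 2 + ε) ^ p * ∑ i, fderiv ℝ (V i) x (EuclideanSpace.single i 1)
      + 2 * p * (‖x‖ ^ 2 + ε) ^ (p - 1) * (‖x‖ ^ 2 * φ x)) = 0 := by
  have hw : ContDiff ℝ 1 fun y : EuclideanSpace ℝ (Fin N) => (‖y‖ ^ 2 + ε) ^ p :=
    ((contDiff_norm_sq ℝ).add contDiff_const).rpow_const_of_ne fun x => by positivity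
  have hg (i : Fin N) : ContDiff ℝ 1 fun y => (‖y‖ ^ 2 + ε) ^ p * V i y := hw.mul (hV i)
  have hgc (i : Fin N) : HasCompactSupport fun y => (‖y‖ ^ 2 + ε) ^ p * V i y := (hc i).mul_left
  have hpt (x : EuclideanSpace ℝ (Fin N)) :
      (‖x‖ ^ 2 + ε) ^ p * ∑ i, fderiv ℝ (V i) x (EuclideanSpace.single i 1)
        + 2 * p * (‖x‖ ^ 2 + ε) ^ (p - 1) * (‖x‖ ^ 2 * φ x)
      = ∑ i, fderiv ℝ (fun y => (‖y‖ ^ 2 + ε) ^ p * V i y) x (EuclideanSpace.single i 1) := by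
    rw [← hφ x, Finset.mul_sum, Finset.mul_sum, ← Finset.sum_add_distrib]
    refine Finset.sum_congr rfl fun i _ => ?_
    rw [fderiv_fun_mul (hw.differentiable one_ne_zero x) ((hV i).differentiable one_ne_zero x)]
    simp only [add_apply, smul_apply, smul_eq_mul, fderiv_rpow_norm_sq_add p hε]
    ring
  simp_rw [hpt]
  rw [integral_finsetSum _ fun i _ => ?_]
  · exact Finset.sum_eq_zero fun i _ => integral_fderiv_apply_eq_zero (hg i) (hgc i) _
  · exact (((hg i).continuous_fderiv one_ne_zero).clm_apply
      continuous_const).integrable_of_hasCompactSupport ((hgc i).fderiv_apply ℝ _)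

/-- Divergence theorem for `‖x‖ ^ (2 * p) • V`, where the radial part of `V` vanishes
quadratically at the origin. -/
lemma integral_norm_rpow_mul_div_eq_zero {p : ℝ} (hp : p < 0) (hN : 1 ≤ N)
    (hNp : -(N : ℝ) < 2 * p)
    {V : Fin N → EuclideanSpace ℝ (Fin N) → ℝ} (hV : ∀ i, ContDiff ℝ 1 (V i))
    (hc : ∀ i, HasCompactSupport (V i)) {φ : EuclideanSpace ℝ (Fin N) → ℝ}
    (hφ : ∀ x, ∑ i, x i * V i x = ‖x‖ ^ 2 * φ x) (hφ₁ : Continuous φ)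
    (hφ₂ : HasCompactSupport φ) {ψ : EuclideanSpace ℝ (Fin N) → ℝ}
    (hψ : ∀ x, ψ x = ∑ i, fderiv ℝ (V i) x (EuclideanSpace.single i 1)) (hψ₁ : Continuous ψ)
    (hψ₂ : HasCompactSupport ψ) :
    (∫ x, ‖x‖ ^ (2 * p) * ψ x) + 2 * p * ∫ x, ‖x‖ ^ (2 * p) * φ x = 0 := by
  have : Nonempty (Fin N) := ⟨⟨0, hN⟩⟩
  have hψi := integrable_norm_rpow_mul hN hNp hψ₁ hψ₂
  have hφi := integrable_norm_rpow_mul hN hNp hφ₁ hφ₂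
  have hpow (x : EuclideanSpace ℝ (Fin N)) : ‖x‖ ^ (2 * p) = (‖x‖ ^ 2) ^ p := by
    rw [← Real.rpow_natCast_mul (norm_nonneg x)]
    norm_num
  have hne : ∀ᵐ x : EuclideanSpace ℝ (Fin N), x ≠ 0 := by
    simp [ae_iff, measure_singleton]
  have key := tendsto_integral_of_dominated_convergence (μ := volume)
    (F := fun (n : ℕ) (x : EuclideanSpace ℝ (Fin N)) => (‖x‖ ^ 2 + 1 / ((n : ℝ) + 1)) ^ p * ψ x
      + 2 * p * (‖x‖ ^ 2 + 1 / ((n : ℝ) + 1)) ^ (p - 1) * (‖x‖ ^ 2 * φ x))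
    (f := fun x => ‖x‖ ^ (2 * p) * ψ x + 2 * p * (‖x‖ ^ (2 * p) * φ x))
    (fun x => |‖x‖ ^ (2 * p) * ψ x| + |2 * p| * |‖x‖ ^ (2 * p) * φ x|)
    (fun n => ?_) (hψi.abs.add (hφi.abs.const_mul _)) (fun n => ?_) ?_
  · have hz (n : ℕ) := integral_div_regularised_eq_zero p
      (ε := 1 / ((n : ℝ) + 1)) (by positivity) hV hc hφ
    simp_rw [← hψ] at hz
    simp_rw [hz] at key
    rw [integral_add hψi (hφi.const_mul _), integral_const_mul] at key
    exact tendsto_nhds_unique key tendsto_const_nhds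
  · have hb (x : EuclideanSpace ℝ (Fin N)) : ‖x‖ ^ 2 + 1 / ((n : ℝ) + 1) ≠ 0 := by positivity
    have hk : Continuous fun x : EuclideanSpace ℝ (Fin N) => ‖x‖ ^ 2 + 1 / ((n : ℝ) + 1) := by
      fun_prop
    have h1 (q : ℝ) := hk.rpow_const (p := q) fun x => Or.inl (hb x)
    exact (((h1 p).mul hψ₁).add ((continuous_const.mul (h1 (p - 1))).mul
      (((continuous_norm).pow 2).mul hφ₁))).aestronglyMeasurable
  · filter_upwards [hne] with x hx
    have hx0 : 0 < ‖x‖ ^ 2 := by positivity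
    set ε : ℝ := 1 / ((n : ℝ) + 1)
    have hε : 0 < ε := by positivity
    have h1 : (‖x‖ ^ 2 + ε) ^ p ≤ (‖x‖ ^ 2) ^ p :=
      Real.rpow_le_rpow_of_nonpos hx0 (by linarith) hp.le
    have h2 : (‖x‖ ^ 2 + ε) ^ (p - 1) * ‖x‖ ^ 2 ≤ (‖x‖ ^ 2) ^ p := by
      calc _ ≤ (‖x‖ ^ 2) ^ (p - 1) * ‖x‖ ^ 2 := by
            gcongr ?_ * _
            exact Real.rpow_le_rpow_of_nonpos hx0 (by linarith) (by linarith)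
        _ = _ := by rw [← Real.rpow_add_one hx0.ne']; norm_num
    rw [Real.norm_eq_abs, hpow]
    refine (abs_add_le _ _).trans (add_le_add ?_ ?_)
    · rw [abs_mul, abs_mul, abs_of_nonneg (by positivity : 0 ≤ (‖x‖ ^ 2 + ε) ^ p),
        abs_of_nonneg (by positivity : 0 ≤ (‖x‖ ^ 2) ^ p)]
      gcongr
    · rw [mul_assoc (2 * p), ← mul_assoc (_ ^ (p - 1)), abs_mul (2 * p), abs_mul _ (φ x),
        abs_mul _ (φ x), abs_of_nonneg (by positivity : 0 ≤ (‖x‖ ^ 2 + ε) ^ (p - 1) * ‖x‖ ^ 2),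
        abs_of_nonneg (by positivity : 0 ≤ (‖x‖ ^ 2) ^ p)]
      gcongr
  · filter_upwards [hne] with x hx
    have hx0 : 0 < ‖x‖ ^ 2 := by positivity
    have hε : Tendsto (fun n : ℕ => ‖x‖ ^ 2 + 1 / ((n : ℝ) + 1)) atTop (nhds (‖x‖ ^ 2)) := by
      simpa using tendsto_one_div_add_atTop_nhds_zero_nat.const_add (‖x‖ ^ 2)
    have h1 (q : ℝ) := hε.rpow_const (p := q) (Or.inl hx0.ne')
    have h2 : (‖x‖ ^ 2) ^ p = (‖x‖ ^ 2) ^ (p - 1) * ‖x‖ ^ 2 := by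
      rw [← Real.rpow_add_one hx0.ne']; norm_num
    have h3 : ‖x‖ ^ (2 * p) * ψ x + 2 * p * (‖x‖ ^ (2 * p) * φ x) =
        (‖x‖ ^ 2) ^ p * ψ x + 2 * p * (‖x‖ ^ 2) ^ (p - 1) * (‖x‖ ^ 2 * φ x) := by
      rw [hpow]
      linear_combination (2 * p * φ x) * h2
    rw [h3]
    exact ((h1 p).mul_const _).add (((h1 (p - 1)).const_mul _).mul_const _)

end WeightedIntegrals

section WeightedQuadraticForms

variable {N : ℕ} {s : ℝ}

lemma integral_norm_rpow_mul_linear (hN : 1 ≤ N) (hs : -(N : ℝ) < s)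
    {f g : EuclideanSpace ℝ (Fin N) → ℝ} (hf : Continuous f) (hg : Continuous g)
    (hfc : HasCompactSupport f) (hgc : HasCompactSupport g) (a b : ℝ) :
    ∫ x, ‖x‖ ^ s * (a * f x + b * g x) =
      a * (∫ x, ‖x‖ ^ s * f x) + b * ∫ x, ‖x‖ ^ s * g x := by
  rw [← integral_const_mul, ← integral_const_mul,
    ← integral_add ((integrable_norm_rpow_mul hN hs hf hfc).const_mul a)
      ((integrable_norm_rpow_mul hN hs hg hgc).const_mul b)]
  congr 1 with x
  ring

lemma integral_norm_rpow_mul_sq_add (hN : 1 ≤ N) (hs : -(N : ℝ) < s)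
    {f g : EuclideanSpace ℝ (Fin N) → ℝ} (hf : Continuous f) (hg : Continuous g)
    (hfc : HasCompactSupport f) (hgc : HasCompactSupport g) (a b : ℝ) :
    ∫ x, ‖x‖ ^ s * (a * f x + b * g x) ^ 2 = a ^ 2 * (∫ x, ‖x‖ ^ s * f x ^ 2)
      + 2 * a * b * (∫ x, ‖x‖ ^ s * (f x * g x)) + b ^ 2 * ∫ x, ‖x‖ ^ s * g x ^ 2 := by
  have h1 := integral_norm_rpow_mul_linear hN hs (f := fun x => a * (f x * f x) + 2 * b * (f x * g x))
    (g := fun x => g x * g x) (by fun_prop) (by fun_prop)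
    (hfc.mul_left.mul_left.add hgc.mul_left.mul_left) hgc.mul_left a (b ^ 2)
  have h2 := integral_norm_rpow_mul_linear hN hs (f := fun x => f x * f x)
    (g := fun x => f x * g x) (by fun_prop) (by fun_prop) hfc.mul_left hgc.mul_left a (2 * b)
  simp_rw [sq (f _), sq (g _)]
  rw [h2] at h1
  refine Eq.trans ?_ (h1.trans (by ring))
  congr 1 with x
  ring

lemma quadratic_norm_rpow_nonneg (hN : 1 ≤ N) (hs : -(N : ℝ) < s)
    {f g : EuclideanSpace ℝ (Fin N) → ℝ} (hf : Continuous f) (hg : Continuous g)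
    (hfc : HasCompactSupport f) (hgc : HasCompactSupport g) (a b : ℝ) :
    0 ≤ a ^ 2 * (∫ x, ‖x‖ ^ s * f x ^ 2)
      + 2 * a * b * (∫ x, ‖x‖ ^ s * (f x * g x)) + b ^ 2 * ∫ x, ‖x‖ ^ s * g x ^ 2 := by
  rw [← integral_norm_rpow_mul_sq_add hN hs hf hg hfc hgc]
  exact integral_nonneg fun x => by positivity

end WeightedQuadraticForms

section CompactSupport

variable {X : Type*} [TopologicalSpace X]

lemma hasCompactSupport_linear {f g : X → ℝ} (hf : HasCompactSupport f)
    (hg : HasCompactSupport g) (a b : ℝ) : HasCompactSupport fun x => a * f x + b * g x := by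
  have h1 : HasCompactSupport fun x => a * f x := hf.mul_left
  have h2 : HasCompactSupport fun x => b * g x := hg.mul_left
  exact h1.add h2

lemma hasCompactSupport_finsetSum {ι : Type*} {f : ι → X → ℝ}
    (t : Finset ι) (hf : ∀ i ∈ t, HasCompactSupport (f i)) :
    HasCompactSupport fun x => ∑ i ∈ t, f i x := by
  classical
  induction t using Finset.induction_on with
  | empty =>
    simp only [Finset.sum_empty]
    exact HasCompactSupport.zero
  | insert a t ha ih =>
    simp_rw [Finset.sum_insert ha]
    exact (hf a (by simp)).add (ih fun i hi => hf i (by simp [hi]))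

end CompactSupport

section HardyRellich

variable {N : ℕ} {u : EuclideanSpace ℝ (Fin N) → ℝ}

lemma fderiv_apply_self_eq_sum (x : EuclideanSpace ℝ (Fin N)) :
    fderiv ℝ u x x = ∑ i, x i * fderiv ℝ u x (EuclideanSpace.single i 1) := by
  have h := congrArg (fderiv ℝ u x) ((EuclideanSpace.basisFun (Fin N) ℝ).sum_repr x)
  rw [← h]
  simp [map_sum]

lemma contDiff_fderiv_apply_const (hu : ContDiff ℝ (⊤ : ℕ∞) u) (v : EuclideanSpace ℝ (Fin N)) :
    ContDiff ℝ (⊤ : ℕ∞) fun y => fderiv ℝ u y v :=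
  (hu.fderiv_right (m := (⊤ : ℕ∞)) (by simp)).clm_apply contDiff_const

lemma continuous_lap (hu : ContDiff ℝ (⊤ : ℕ∞) u) : Continuous (lap u) :=
  continuous_finsetSum _ fun _ _ =>
    (contDiff_fderiv_apply_const (contDiff_fderiv_apply_const hu _) _).continuous

lemma hasCompactSupport_lap (hc : HasCompactSupport u) : HasCompactSupport (lap u) :=
  hasCompactSupport_finsetSum _ fun _ _ => (hc.fderiv_apply ℝ _).fderiv_apply ℝ _

lemma continuous_norm_sq_mul_lap (hu : ContDiff ℝ (⊤ : ℕ∞) u) :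
    Continuous fun x => ‖x‖ ^ 2 * lap u x :=
  (continuous_norm.pow 2).mul (continuous_lap hu)

lemma hasCompactSupport_norm_sq_mul_lap (hc : HasCompactSupport u) :
    HasCompactSupport fun x => ‖x‖ ^ 2 * lap u x := by
  refine (hasCompactSupport_lap hc).mono fun x hx h => hx ?_
  simp [h]

lemma continuous_fderiv_apply_self (hu : ContDiff ℝ (⊤ : ℕ∞) u) :
    Continuous fun x => fderiv ℝ u x x :=
  (hu.continuous_fderiv (by simp)).clm_apply continuous_id

lemma hasCompactSupport_fderiv_apply_self (hc : HasCompactSupport u) :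
    HasCompactSupport fun x => fderiv ℝ u x x := by
  refine (hc.fderiv ℝ).mono fun x hx h => hx ?_
  simp [h]

lemma fderiv_apply_self_sq_le (x : EuclideanSpace ℝ (Fin N)) :
    fderiv ℝ u x x ^ 2 ≤ ‖x‖ ^ 2 * ∑ i, fderiv ℝ u x (EuclideanSpace.single i 1) ^ 2 := by
  rw [fderiv_apply_self_eq_sum, EuclideanSpace.real_norm_sq_eq]
  exact Finset.sum_mul_sq_le_sq_mul_sq _ _ _

lemma continuous_norm_sq_mul_sum_fderiv_sq (hu : ContDiff ℝ (⊤ : ℕ∞) u) :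
    Continuous fun x => ‖x‖ ^ 2 * ∑ i, fderiv ℝ u x (EuclideanSpace.single i 1) ^ 2 :=
  (continuous_norm.pow 2).mul (continuous_finsetSum _ fun _ _ =>
    (contDiff_fderiv_apply_const hu _).continuous.pow 2)

lemma hasCompactSupport_norm_sq_mul_sum_fderiv_sq (hc : HasCompactSupport u) :
    HasCompactSupport fun x => ‖x‖ ^ 2 * ∑ i, fderiv ℝ u x (EuclideanSpace.single i 1) ^ 2 := by
  refine (hc.fderiv ℝ).mono fun x hx h => hx ?_
  simp [h]

lemma fderiv_coord_apply_single (x : EuclideanSpace ℝ (Fin N)) (i : Fin N) :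
    fderiv ℝ (fun y : EuclideanSpace ℝ (Fin N) => y i) x (EuclideanSpace.single i 1) = 1 := by
  have h : HasFDerivAt (fun y : EuclideanSpace ℝ (Fin N) => y i)
    (EuclideanSpace.proj i : EuclideanSpace ℝ (Fin N) →L[ℝ] ℝ) x :=
    (EuclideanSpace.proj i : EuclideanSpace ℝ (Fin N) →L[ℝ] ℝ).hasFDerivAt
  rw [h.fderiv]
  simp

/-- Integration by parts along the Euler field `x ↦ x`. -/
lemma integral_norm_rpow_mul_sq_add_radial {p : ℝ} (hp : p < 0) (hN : 1 ≤ N)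
    (hNp : -(N : ℝ) < 2 * p) (hu : ContDiff ℝ (⊤ : ℕ∞) u) (hc : HasCompactSupport u) :
    (N + 2 * p) * (∫ x, ‖x‖ ^ (2 * p) * u x ^ 2)
      + 2 * ∫ x, ‖x‖ ^ (2 * p) * (u x * fderiv ℝ u x x) = 0 := by
  have hu1 : ContDiff ℝ 1 u := hu.of_le (by simp)
  have hdu := hu1.differentiable one_ne_zero
  have hQ := continuous_fderiv_apply_self hu
  have hQc := hasCompactSupport_fderiv_apply_self hc
  have hcoord (i : Fin N) : ContDiff ℝ 1 fun x : EuclideanSpace ℝ (Fin N) => x i :=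
    (EuclideanSpace.proj i : EuclideanSpace ℝ (Fin N) →L[ℝ] ℝ).contDiff
  have key := integral_norm_rpow_mul_div_eq_zero hp hN hNp
    (V := fun i x => x i * (u x * u x)) (φ := fun x => u x * u x)
    (ψ := fun x => N * (u x * u x) + 2 * (u x * fderiv ℝ u x x))
    (fun i => (hcoord i).mul (hu1.mul hu1)) (fun i => hc.mul_left.mul_left)
    (fun x => by
      rw [EuclideanSpace.real_norm_sq_eq, Finset.sum_mul]
      exact Finset.sum_congr rfl fun i _ => by ring)
    (hu1.continuous.mul hu1.continuous) hc.mul_left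
    (fun x => by
      have (i : Fin N) : fderiv ℝ (fun x => x i * (u x * u x)) x (EuclideanSpace.single i 1) =
          u x * u x + 2 * u x * (x i * fderiv ℝ u x (EuclideanSpace.single i 1)) := by
        rw [fderiv_fun_mul ((hcoord i).differentiable one_ne_zero x) ((hdu x).fun_mul (hdu x)),
          fderiv_fun_mul (hdu x) (hdu x)]
        simp only [add_apply, smul_apply, smul_eq_mul, fderiv_coord_apply_single]
        ring
      simp_rw [this, Finset.sum_add_distrib, ← Finset.mul_sum, ← fderiv_apply_self_eq_sum]
      simp
      ring)
    (by have := hu1.continuous; fun_prop) (hc.mul_left.mul_left.add hQc.mul_left.mul_left)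
  have hsum := integral_norm_rpow_mul_linear hN hNp (f := fun x => u x * u x)
    (g := fun x => u x * fderiv ℝ u x x) (hu1.continuous.mul hu1.continuous)
    (hu1.continuous.mul hQ) hc.mul_left hQc.mul_left N 2
  rw [hsum] at key
  simp_rw [sq (u _)]
  linear_combination key

/-- Weighted Green identity. -/
lemma integral_norm_rpow_mul_green {p : ℝ} (hp : p < 0) (hN : 1 ≤ N)
    (hNp : -(N : ℝ) < 2 * p) (hu : ContDiff ℝ (⊤ : ℕ∞) u) (hc : HasCompactSupport u) :
    (∫ x, ‖x‖ ^ (2 * p) *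
        (‖x‖ ^ 2 * ∑ i, fderiv ℝ u x (EuclideanSpace.single i 1) ^ 2))
      + (∫ x, ‖x‖ ^ (2 * p) * (u x * (‖x‖ ^ 2 * lap u x)))
      + (2 + 2 * p) * ∫ x, ‖x‖ ^ (2 * p) * (u x * fderiv ℝ u x x) = 0 := by
  have hu1 : ContDiff ℝ 1 u := hu.of_le (by simp)
  have hdu := hu1.differentiable one_ne_zero
  have hQ := continuous_fderiv_apply_self hu
  have hQc := hasCompactSupport_fderiv_apply_self hc
  have hd (i : Fin N) : ContDiff ℝ 1 fun y => fderiv ℝ u y (EuclideanSpace.single i 1) :=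
    (contDiff_fderiv_apply_const hu _).of_le (by simp)
  have hdc (i : Fin N) : HasCompactSupport fun y => fderiv ℝ u y (EuclideanSpace.single i 1) :=
    hc.fderiv_apply ℝ _
  have hn : ContDiff ℝ 1 fun x : EuclideanSpace ℝ (Fin N) => ‖x‖ ^ 2 := contDiff_norm_sq ℝ
  have hnd (x : EuclideanSpace ℝ (Fin N)) (i : Fin N) :
      fderiv ℝ (fun y : EuclideanSpace ℝ (Fin N) => ‖y‖ ^ 2) x (EuclideanSpace.single i 1)
        = 2 * x i := by
    rw [(hasStrictFDerivAt_norm_sq x).hasFDerivAt.fderiv]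
    simp [EuclideanSpace.inner_single_right]
  have hG := continuous_norm_sq_mul_sum_fderiv_sq hu
  have hGc := hasCompactSupport_norm_sq_mul_sum_fderiv_sq hc
  have hK : Continuous fun x => u x * (‖x‖ ^ 2 * lap u x) :=
    hu1.continuous.mul (continuous_norm_sq_mul_lap hu)
  have hKc : HasCompactSupport fun x => u x * (‖x‖ ^ 2 * lap u x) :=
    (hasCompactSupport_norm_sq_mul_lap hc).mul_left
  have hJ : Continuous fun x => u x * fderiv ℝ u x x := hu1.continuous.mul hQ
  have hJc : HasCompactSupport fun x => u x * fderiv ℝ u x x := hQc.mul_left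
  have hGKc := hasCompactSupport_linear hGc hKc 1 1
  have hψc := hasCompactSupport_linear hGKc hJc 1 2
  simp only [one_mul] at hGKc hψc
  have key := integral_norm_rpow_mul_div_eq_zero hp hN hNp
    (V := fun i x => ‖x‖ ^ 2 * (u x * fderiv ℝ u x (EuclideanSpace.single i 1)))
    (φ := fun x => u x * fderiv ℝ u x x)
    (ψ := fun x => ‖x‖ ^ 2 * ∑ i, fderiv ℝ u x (EuclideanSpace.single i 1) ^ 2
      + u x * (‖x‖ ^ 2 * lap u x) + 2 * (u x * fderiv ℝ u x x))
    (fun i => hn.mul (hu1.mul (hd i))) (fun i => (hdc i).mul_left.mul_left)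
    (fun x => by
      rw [fderiv_apply_self_eq_sum, Finset.mul_sum, Finset.mul_sum]
      exact Finset.sum_congr rfl fun i _ => by ring)
    hJ hJc
    (fun x => by
      have (i : Fin N) : fderiv ℝ (fun x =>
            ‖x‖ ^ 2 * (u x * fderiv ℝ u x (EuclideanSpace.single i 1))) x
            (EuclideanSpace.single i 1) =
          ‖x‖ ^ 2 * fderiv ℝ u x (EuclideanSpace.single i 1) ^ 2
          + u x * (‖x‖ ^ 2 * fderiv ℝ (fun y => fderiv ℝ u y (EuclideanSpace.single i 1)) x
            (EuclideanSpace.single i 1))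
          + 2 * (u x * (x i * fderiv ℝ u x (EuclideanSpace.single i 1))) := by
        have hdi := (hd i).differentiable one_ne_zero x
        rw [fderiv_fun_mul (hn.differentiable one_ne_zero x) ((hdu x).fun_mul hdi),
          fderiv_fun_mul (hdu x) hdi]
        simp only [add_apply, smul_apply, smul_eq_mul, hnd]
        ring
      simp_rw [this, Finset.sum_add_distrib, ← Finset.mul_sum, ← fderiv_apply_self_eq_sum]
      rfl)
    ((hG.add hK).add (continuous_const.mul hJ)) hψc
  have hs₁ := integral_norm_rpow_mul_linear hN hNp (hG.add hK) hJ hGKc hJc 1 2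
  have hs₂ := integral_norm_rpow_mul_linear hN hNp hG hK hGc hKc 1 1
  simp only [one_mul, Pi.add_apply] at hs₁ hs₂
  rw [hs₁, hs₂] at key
  linear_combination key

/-- Weighted Hardy inequality, with the radial derivative on the right-hand side. -/
lemma hardy_radial {p : ℝ} (hp : p < 0) (hN : 1 ≤ N)
    (hNp : -(N : ℝ) < 2 * p) (hu : ContDiff ℝ (⊤ : ℕ∞) u) (hc : HasCompactSupport u) :
    (N + 2 * p) ^ 2 / 4 * (∫ x, ‖x‖ ^ (2 * p) * u x ^ 2)
      ≤ ∫ x, ‖x‖ ^ (2 * p) * fderiv ℝ u x x ^ 2 := by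
  have h := quadratic_norm_rpow_nonneg hN hNp hu.continuous (continuous_fderiv_apply_self hu) hc
    (hasCompactSupport_fderiv_apply_self hc) ((N + 2 * p) / 2) 1
  linear_combination h + (N + 2 * p) / 2 * integral_norm_rpow_mul_sq_add_radial hp hN hNp hu hc

lemma integral_radial_sq_le {p : ℝ} (hN : 1 ≤ N)
    (hNp : -(N : ℝ) < 2 * p) (hu : ContDiff ℝ (⊤ : ℕ∞) u) (hc : HasCompactSupport u) :
    (∫ x, ‖x‖ ^ (2 * p) * fderiv ℝ u x x ^ 2) ≤ ∫ x, ‖x‖ ^ (2 * p) *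
        (‖x‖ ^ 2 * ∑ i, fderiv ℝ u x (EuclideanSpace.single i 1) ^ 2) := by
  have hQ := continuous_fderiv_apply_self hu
  have hQc := hasCompactSupport_fderiv_apply_self hc
  have i1 := integrable_norm_rpow_mul hN hNp (hQ.mul hQ) hQc.mul_left
  simp_rw [← sq] at i1
  refine integral_mono i1 (integrable_norm_rpow_mul hN hNp
    (continuous_norm_sq_mul_sum_fderiv_sq hu)
    (hasCompactSupport_norm_sq_mul_sum_fderiv_sq hc)) fun x => ?_
  have := fderiv_apply_self_sq_le (u := u) x
  dsimp only
  gcongr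

/-- Coercivity of the weighted Dirichlet form against `u ↦ -∫ ‖x‖ ^ (2 * p) * u * f` controls the
radial derivative by `f`. -/
lemma integral_radial_sq_le_of_coercive {p c : ℝ} (hp : p < 0) (hN : 1 ≤ N)
    (hNp : -(N : ℝ) < 2 * p) (hc0 : 0 < c) (hu : ContDiff ℝ (⊤ : ℕ∞) u) (hc : HasCompactSupport u)
    {f : EuclideanSpace ℝ (Fin N) → ℝ} (hf : Continuous f) (hfc : HasCompactSupport f)
    (h : c * (∫ x, ‖x‖ ^ (2 * p) *
        (‖x‖ ^ 2 * ∑ i, fderiv ℝ u x (EuclideanSpace.single i 1) ^ 2))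
      ≤ -∫ x, ‖x‖ ^ (2 * p) * (u x * f x)) :
    (∫ x, ‖x‖ ^ (2 * p) * fderiv ℝ u x x ^ 2)
      ≤ 4 / (c ^ 2 * (N + 2 * p) ^ 2) * ∫ x, ‖x‖ ^ (2 * p) * f x ^ 2 := by
  have hm : 0 < (N : ℝ) + 2 * p := by linarith
  have h1 := hardy_radial hp hN hNp hu hc
  have h2 := integral_radial_sq_le hN hNp hu hc
  have h3 := quadratic_norm_rpow_nonneg hN hNp hu.continuous hf hc hfc
    (c * (N + 2 * p) ^ 2 / 4) 1
  set m : ℝ := N + 2 * p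
  set R := ∫ x, ‖x‖ ^ (2 * p) * fderiv ℝ u x x ^ 2
  set Z := ∫ x, ‖x‖ ^ (2 * p) * u x ^ 2
  set K := ∫ x, ‖x‖ ^ (2 * p) * (u x * f x)
  have h4 : c ^ 2 * m ^ 2 / 4 * (m ^ 2 / 4 * Z) ≤ c ^ 2 * m ^ 2 / 4 * R := by gcongr
  have h5 : c * m ^ 2 / 2 * (c * R) ≤ c * m ^ 2 / 2 * -K := by
    gcongr
    exact (by gcongr : c * R ≤ _).trans h
  rw [div_mul_eq_mul_div, le_div_iff₀ (by positivity)]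
  linear_combination 4 * h3 + 4 * h4 + 4 * h5

/-- Radial part of the weighted Rellich inequalities for the Laplacian and for the divergence-form
operator, written as `‖x‖ ^ 2 * Δ u + β * (x · ∇ u)`. -/
lemma integral_radial_sq_le_rellich {p β : ℝ} (hp : p < 0) (hN : 1 ≤ N)
    (hNp : -(N : ℝ) < 2 * p) {c : ℝ} (hc0 : 0 < c) (hc1 : c ≤ 1)
    (hcβ : (1 - c) * (N + 2 * p) ≥ 2 * (2 + 2 * p - β))
    (hu : ContDiff ℝ (⊤ : ℕ∞) u) (hc : HasCompactSupport u) :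
    (∫ x, ‖x‖ ^ (2 * p) * fderiv ℝ u x x ^ 2)
      ≤ 4 / (c ^ 2 * (N + 2 * p) ^ 2) *
        ∫ x, ‖x‖ ^ (2 * p) * (1 * (‖x‖ ^ 2 * lap u x) + β * fderiv ℝ u x x) ^ 2 := by
  have hQ := continuous_fderiv_apply_self hu
  have hQc := hasCompactSupport_fderiv_apply_self hc
  have hP := continuous_norm_sq_mul_lap hu
  have hPc := hasCompactSupport_norm_sq_mul_lap hc
  refine integral_radial_sq_le_of_coercive hp hN hNp hc0 hu hc
    ((continuous_const.mul hP).add (continuous_const.mul hQ))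
    (hasCompactSupport_linear hPc hQc 1 β) ?_
  have hPu : HasCompactSupport fun x => u x * (‖x‖ ^ 2 * lap u x) := hPc.mul_left
  have hQu : HasCompactSupport fun x => u x * fderiv ℝ u x x := hQc.mul_left
  have hK := integral_norm_rpow_mul_linear hN hNp (f := fun x => u x * (‖x‖ ^ 2 * lap u x))
    (g := fun x => u x * fderiv ℝ u x x) (hu.continuous.mul hP) (hu.continuous.mul hQ)
    hPu hQu 1 β
  have hpt (x : EuclideanSpace ℝ (Fin N)) :
      u x * (1 * (‖x‖ ^ 2 * lap u x) + β * fderiv ℝ u x x) =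
        1 * (u x * (‖x‖ ^ 2 * lap u x)) + β * (u x * fderiv ℝ u x x) := by ring
  simp_rw [hpt]
  rw [hK]
  have h1 := hardy_radial hp hN hNp hu hc
  have h2 := integral_radial_sq_le hN hNp hu hc
  have h3 := integral_norm_rpow_mul_sq_add_radial hp hN hNp hu hc
  have h4 := integral_norm_rpow_mul_green hp hN hNp hu hc
  have hm : 0 < (N : ℝ) + 2 * p := by linarith
  have hZ : 0 ≤ ∫ x, ‖x‖ ^ (2 * p) * u x ^ 2 := integral_nonneg fun x => by positivity
  set m : ℝ := N + 2 * p
  set B := ∫ x, ‖x‖ ^ (2 * p) *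
    (‖x‖ ^ 2 * ∑ i, fderiv ℝ u x (EuclideanSpace.single i 1) ^ 2)
  set Z := ∫ x, ‖x‖ ^ (2 * p) * u x ^ 2
  have h5 : (1 - c) * (m ^ 2 / 4 * Z) ≤ (1 - c) * B :=
    mul_le_mul_of_nonneg_left (h1.trans h2) (by linarith)
  have h6 : (m * Z / 4) * (2 * (2 + 2 * p - β)) ≤ (m * Z / 4) * ((1 - c) * m) :=
    mul_le_mul_of_nonneg_left hcβ (by positivity)
  linear_combination h5 + h6 + h4 - (2 + 2 * p - β) / 2 * h3

end HardyRellich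

/-- equivalence of the weighted energies
`∫ |div(|x|^α ∇u)|²` and `∫ |x|^{2α}|Δu|²` on `C_c^∞(ℝ^N)`. -/
theorem stmt14 (N : ℕ) (hN : 5 ≤ N) (α : ℝ) (hα1 : 0 < α) (hα2 : α < 2) :
    ∃ C : ℝ, 1 < C ∧ ∀ u : EuclideanSpace ℝ (Fin N) → ℝ,
      ContDiff ℝ (⊤ : ℕ∞) u → HasCompactSupport u →
      ((1/C) * (∫ x, (wOp α u x)^2) ≤ ∫ x, ‖x‖^(2*α) * (lap u x)^2) ∧
      ((∫ x, ‖x‖^(2*α) * (lap u x)^2) ≤ C * ∫ x, (wOp α u x)^2) := by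
  have hN1 : 1 ≤ N := by omega
  have hN5 : (5 : ℝ) ≤ N := by exact_mod_cast hN
  have hp : α - 2 < 0 := by linarith
  have hNp : -(N : ℝ) < 2 * (α - 2) := by linarith
  have hm : 0 < (N : ℝ) + 2 * (α - 2) := by linarith
  obtain ⟨c, hc0, hc1, hcα⟩ : ∃ c : ℝ, 0 < c ∧ c ≤ 1 ∧
      (1 - c) * (N + 2 * (α - 2)) ≥ 2 * (2 + 2 * (α - 2)) := by
    rcases le_total α 1 with h | h
    · exact ⟨1, one_pos, le_rfl, by linarith⟩
    · refine ⟨(N - 2 * α) / (N + 2 * (α - 2)), div_pos (by linarith) hm, ?_, ?_⟩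
      · rw [div_le_one hm]
        linarith
      · rw [sub_mul, div_mul_cancel₀ _ hm.ne']
        linarith
  set K := 4 / (c ^ 2 * ((N : ℝ) + 2 * (α - 2)) ^ 2) with hK
  have hK0 : 0 < K := by positivity
  refine ⟨2 + 2 * α ^ 2 * K, by nlinarith [mul_pos (pow_pos hα1 2) hK0], fun u hu hc => ?_⟩
  have : Nonempty (Fin N) := ⟨⟨0, hN1⟩⟩
  have hne : ∀ᵐ x : EuclideanSpace ℝ (Fin N), x ≠ 0 := by
    simp [ae_iff, measure_singleton]
  have hpow (x : EuclideanSpace ℝ (Fin N)) (hx : x ≠ 0) :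
      ‖x‖ ^ (2 * (α - 2)) = (‖x‖ ^ (α - 2)) ^ 2 ∧ ‖x‖ ^ (2 * α) = (‖x‖ ^ α) ^ 2 ∧
        ‖x‖ ^ α = ‖x‖ ^ (α - 2) * ‖x‖ ^ 2 := by
    have hx0 : 0 < ‖x‖ := norm_pos_iff.2 hx
    refine ⟨?_, ?_, ?_⟩
    · rw [mul_comm, Real.rpow_mul hx0.le]
      norm_num
    · rw [mul_comm, Real.rpow_mul hx0.le]
      norm_num
    · rw [← Real.rpow_natCast, ← Real.rpow_add hx0]
      norm_num
  have hA : ∫ x, ‖x‖ ^ (2 * α) * lap u x ^ 2 =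
      ∫ x, ‖x‖ ^ (2 * (α - 2)) * (‖x‖ ^ 2 * lap u x) ^ 2 := by
    refine integral_congr_ae ?_
    filter_upwards [hne] with x hx
    obtain ⟨h1, h2, h3⟩ := hpow x hx
    rw [h1, h2, h3]
    ring
  have hD : ∫ x, wOp α u x ^ 2 = ∫ x, ‖x‖ ^ (2 * (α - 2)) *
      (1 * (‖x‖ ^ 2 * lap u x) + α * fderiv ℝ u x x) ^ 2 := by
    refine integral_congr_ae ?_
    filter_upwards [hne] with x hx
    obtain ⟨h1, h2, h3⟩ := hpow x hx
    rw [h1, wOp, h3]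
    ring
  have hQ := continuous_fderiv_apply_self hu
  have hQc := hasCompactSupport_fderiv_apply_self hc
  have hP := continuous_norm_sq_mul_lap hu
  have hPc := hasCompactSupport_norm_sq_mul_lap hc
  have hRA := integral_radial_sq_le_rellich (β := 0) hp hN1 hNp hc0 hc1 (by simpa using hcα) hu hc
  have hRD := integral_radial_sq_le_rellich (β := α) hp hN1 hNp hc0 hc1
    (hcα.trans' (by linarith)) hu hc
  have hexp := integral_norm_rpow_mul_sq_add hN1 hNp hP hQ hPc hQc 1 α
  have hq₁ := quadratic_norm_rpow_nonneg hN1 hNp hP hQ hPc hQc 1 (-α)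
  have hq₂ := quadratic_norm_rpow_nonneg hN1 hNp hP hQ hPc hQc 1 (2 * α)
  simp only [one_mul, zero_mul, add_zero] at hRA hRD hexp hD
  rw [hA, hD]
  rw [← hK] at hRA hRD
  constructor
  · rw [one_div_mul_eq_div, div_le_iff₀ (by positivity)]
    linear_combination hexp + hq₁ + 2 * α ^ 2 * hRA
  · linear_combination hq₂ - 2 * hexp + 2 * α ^ 2 * hRD

end
end
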